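/- Suppose q > 2 and let x ∈ ⁅S,S⁆ with x ∉ Z(S). Then J(S) ≤ C_S(x), the centralizer C_S(x) has order q^5, the center Z(C_S(x)) equals C_{J(S)}(C_S(x)) and has order q^2, and the derived subgroup ⁅C_S(x), C_S(x)⁆ equals the commutator [J(S), C_S(x)] and has order q^2. -/

import Mathlib

open Matrix

/-- The `q`-power Frobenius `x ↦ x ^ (pⁿ)` on `K = GF(q²)` where `q = pⁿ`. -/
noncomputable def frobq (p n : ℕ) [Fact p.Prime] :
    GaloisField p (2 * n) →+* GaloisField p (2 * n) :=
  iterateFrobenius (GaloisField p (2 * n)) p n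

/-- `SU₄(q)`: the subgroup of `SL₄(GF(q²))` of all matrices `A` with `Aᵀ ⬝ σ(A) = 1`,
where `σ` is the `q`-power Frobenius applied entrywise. -/
def SU4 (p n : ℕ) [Fact p.Prime] :
    Subgroup (SpecialLinearGroup (Fin 4) (GaloisField p (2 * n))) where
  carrier := {A | (A : Matrix (Fin 4) (Fin 4) (GaloisField p (2 * n)))ᵀ *
      (A : Matrix (Fin 4) (Fin 4) (GaloisField p (2 * n))).map (frobq p n) = 1}
  one_mem' := by
    simp
  mul_mem' := by
    intro A B hA hB
    simp only [Set.mem_setOf_eq, Matrix.SpecialLinearGroup.coe_mul, Matrix.transpose_mul,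
      Matrix.map_mul] at *
    calc (B : Matrix (Fin 4) (Fin 4) (GaloisField p (2*n)))ᵀ * (A : Matrix _ _ _)ᵀ *
          ((A : Matrix _ _ _).map (frobq p n) * (B : Matrix _ _ _).map (frobq p n))
        = (B : Matrix (Fin 4) (Fin 4) (GaloisField p (2*n)))ᵀ *
            (((A : Matrix _ _ _)ᵀ * (A : Matrix _ _ _).map (frobq p n)) *
              (B : Matrix _ _ _).map (frobq p n)) := by
          noncomm_ring
      _ = 1 := by rw [hA, one_mul, hB]
  inv_mem' := by
    intro A hA
    simp only [Set.mem_setOf_eq] at *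
    have h1 : (A : Matrix (Fin 4) (Fin 4) (GaloisField p (2*n))) *
        ((A⁻¹ : SpecialLinearGroup (Fin 4) (GaloisField p (2*n))) : Matrix _ _ _) = 1 := by
      rw [← Matrix.SpecialLinearGroup.coe_mul, mul_inv_cancel,
        Matrix.SpecialLinearGroup.coe_one]
    have hBt : ((A⁻¹ : SpecialLinearGroup (Fin 4) (GaloisField p (2*n))) : Matrix _ _ _)ᵀ =
        (A : Matrix (Fin 4) (Fin 4) (GaloisField p (2*n))).map (frobq p n) := by
      calc ((A⁻¹ : SpecialLinearGroup (Fin 4) (GaloisField p (2*n))) : Matrix _ _ _)ᵀ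
          = ((A⁻¹ : SpecialLinearGroup (Fin 4) (GaloisField p (2*n))) : Matrix _ _ _)ᵀ *
            ((A : Matrix (Fin 4) (Fin 4) (GaloisField p (2*n)))ᵀ *
              (A : Matrix _ _ _).map (frobq p n)) := by rw [hA, mul_one]
        _ = (((A : Matrix (Fin 4) (Fin 4) (GaloisField p (2*n))) *
              ((A⁻¹ : SpecialLinearGroup (Fin 4) (GaloisField p (2*n))) : Matrix _ _ _))ᵀ) *
            (A : Matrix _ _ _).map (frobq p n) := by
            rw [Matrix.transpose_mul]; noncomm_ring
        _ = (A : Matrix (Fin 4) (Fin 4) (GaloisField p (2*n))).map (frobq p n) := by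
            rw [h1, Matrix.transpose_one, one_mul]
    rw [hBt, ← Matrix.map_mul, h1, Matrix.map_one (frobq p n) (map_zero _) (map_one _)]

/-- `PSU₄(q)`: the quotient of `SU₄(q)` by its center. -/
noncomputable abbrev PSU4 (p n : ℕ) [Fact p.Prime] :=
  ↥(SU4 p n) ⧸ Subgroup.center ↥(SU4 p n)

/-- A subgroup is elementary abelian (for the prime `p`) if it is commutative and every
element has order dividing `p`. -/
def IsElementaryAbelian (p : ℕ) {G : Type*} [Group G] (A : Subgroup G) : Prop :=
  (∀ x ∈ A, ∀ y ∈ A, x * y = y * x) ∧ ∀ x ∈ A, x ^ p = 1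

/-- The Thompson subgroup `J(G)`: the subgroup generated by all elementary abelian
subgroups of maximal order. -/
def Thompson (p : ℕ) (G : Type*) [Group G] : Subgroup G :=
  ⨆ A ∈ {A : Subgroup G | IsElementaryAbelian p A ∧
      ∀ B : Subgroup G, IsElementaryAbelian p B → Nat.card B ≤ Nat.card A}, A

section Involution

variable {K : Type*} [Field K]

theorem exists_frobenius_card_facts [Finite K] {q : ℕ} (hcard : Nat.card K = q ^ 2) (σ : K →+* K)
    (hσ : ∀ x, σ x = x ^ q) :
    Nat.card {x : K // σ x = x} = q ∧ Nat.card {x : K // σ x = -x} = q ∧ ∃ β : K, β + σ β = 1 := by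
  classical
  have hq : 1 < q := by
    have : 1 < Nat.card K := Finite.one_lt_card
    rw [hcard] at this
    exact (one_lt_pow_iff_of_nonneg (Nat.zero_le _) two_ne_zero).1 this
  have hinv : ∀ x, σ (σ x) = x := fun x => by
    have := Fintype.ofFinite K
    rw [hσ, hσ, ← pow_mul, ← sq, ← hcard, Nat.card_eq_fintype_card, FiniteField.pow_card]
  have hroots : ∀ c : K, Nat.card {x : K // σ x = c * x} ≤ q := fun c => by
    set P : Polynomial K := Polynomial.X ^ q - Polynomial.C c * Polynomial.X with hP
    have hdeg : P.natDegree = q := by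
      rw [hP]; compute_degree!
      · split_ifs with h
        · omega
        · simp
      · omega
      · omega
    have hP0 : P ≠ 0 := by
      rintro h; rw [h] at hdeg; simp at hdeg; omega
    calc Nat.card {x : K // σ x = c * x} ≤ Nat.card P.roots.toFinset := by
          refine Nat.card_le_card_of_injective
            (fun x => ⟨x.1, ?_⟩) fun x y h => Subtype.ext (congrArg (fun z => z.1) h)
          have := x.2
          rw [hσ] at this
          rw [Multiset.mem_toFinset, Polynomial.mem_roots hP0]
          simp [hP, this]
      _ ≤ q := by
          rw [Nat.card_eq_fintype_card, Fintype.card_coe]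
          exact (Multiset.toFinset_card_le _).trans ((P.card_roots').trans hdeg.le)
  have h1 := hroots 1
  have h2 := hroots (-1)
  simp only [one_mul, neg_mul] at h1 h2
  let tr : K →+ K := AddMonoidHom.id K + σ.toAddMonoidHom
  have htr : ∀ x, tr x = x + σ x := fun x => rfl
  have hker : Nat.card tr.ker = Nat.card {x : K // σ x = -x} :=
    Nat.card_congr (Equiv.subtypeEquivRight fun x => by
      rw [AddMonoidHom.mem_ker, htr, add_comm, add_eq_zero_iff_eq_neg])
  have hmem : ∀ y ∈ tr.range, σ y = y := by
    rintro _ ⟨x, rfl⟩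
    rw [htr, map_add, hinv, add_comm]
  have hrange : Nat.card tr.range ≤ Nat.card {x : K // σ x = x} :=
    Nat.card_le_card_of_injective (fun y => ⟨y.1, hmem y.1 y.2⟩)
      fun x y h => Subtype.ext (congrArg (fun z => z.1) h)
  have hprod : Nat.card tr.ker * Nat.card tr.range = q ^ 2 := by
    rw [← hcard, ← AddSubgroup.index_ker, AddSubgroup.card_mul_index]
  have hskew : Nat.card {x : K // σ x = -x} = q := by
    nlinarith
  have hr : Nat.card tr.range = q := by
    rw [hker, hskew] at hprod
    exact Nat.eq_of_mul_eq_mul_left (by omega : 0 < q) (by rw [hprod, sq])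
  have hfix : Nat.card {x : K // σ x = x} = q := le_antisymm h1 (hr ▸ hrange)
  refine ⟨hfix, hskew, ?_⟩
  have hbij := (Nat.bijective_iff_injective_and_card
    (fun y : tr.range => (⟨y.1, hmem y.1 y.2⟩ : {x : K // σ x = x}))).2
      ⟨fun x y h => Subtype.ext (congrArg (fun z => z.1) h), hr.trans hfix.symm⟩
  obtain ⟨⟨_, x, rfl⟩, hx⟩ := hbij.2 ⟨1, map_one σ⟩
  exact ⟨x, congrArg (fun z => z.1) hx⟩

theorem exists_mul_frobenius_eq_neg_one [Finite K] {q : ℕ} (hcard : Nat.card K = q ^ 2)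
    (σ : K →+* K) (hσ : ∀ x, σ x = x ^ q) : ∃ ε : K, ε * σ ε = -1 := by
  have hq : 1 < q := by
    have : 1 < Nat.card K := Finite.one_lt_card
    rw [hcard] at this
    exact (one_lt_pow_iff_of_nonneg (Nat.zero_le _) two_ne_zero).1 this
  have hunits : Nat.card Kˣ = (q + 1) * (q - 1) := by
    rw [Nat.card_units, hcard, ← Nat.sq_sub_sq, one_pow]
  obtain ⟨g, hg⟩ := IsCyclic.exists_generator (α := Kˣ)
  have hord : orderOf g = (q + 1) * (q - 1) := by
    rw [orderOf_eq_card_of_forall_mem_zpowers hg, hunits]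
  obtain ⟨k, hk⟩ := (Subgroup.mem_zpowers_iff).1 (hg (-1))
  have hneg : (-1 : Kˣ) ^ (q - 1) = 1 := by
    have h : (-1 : Kˣ) ^ (q - 1) * -1 = -1 := by
      rw [← pow_succ, Nat.sub_add_cancel hq.le]
      ext
      simpa [hσ] using map_neg σ 1
    exact mul_eq_right.1 h
  have hdvd : ((q + 1 : ℕ) : ℤ) ∣ k := by
    have : g ^ (k * (q - 1 : ℕ)) = 1 := by
      rw [_root_.zpow_mul, hk, zpow_natCast, hneg]
    have := orderOf_dvd_iff_zpow_eq_one.2 this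
    rw [hord, Nat.cast_mul] at this
    exact Int.dvd_of_mul_dvd_mul_right (by omega) this
  obtain ⟨m, rfl⟩ := hdvd
  refine ⟨(g ^ m : Kˣ), ?_⟩
  rw [hσ, ← pow_succ', ← Units.val_pow_eq_pow_val, ← zpow_natCast, ← _root_.zpow_mul, mul_comm, hk]
  simp

theorem exists_skew_ne_zero [Finite K] {σ : K →+* K}
    (h : 1 < Nat.card {x : K // σ x = -x}) : ∃ η : K, η ≠ 0 ∧ σ η = -η := by
  have := Finite.one_lt_card_iff_nontrivial.1 h
  obtain ⟨η, hη⟩ := exists_ne (⟨0, by simp⟩ : {a : K // σ a = -a})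
  exact ⟨η, fun h => hη (Subtype.ext h), η.2⟩

end Involution


/-- Coordinates for the unipotent radical of a Borel subgroup of the unitary group of a
four-dimensional hermitian space with Witt index two: `t` parametrises the Levi part, and `a`, `b`,
`d` are the entries of a skew-hermitian two by two matrix. -/
@[ext]
structure UnitaryUnipotent {K : Type*} [Field K] (σ : K →+* K) (hσ : Function.Involutive σ) where
  t : K
  a : K
  b : K
  d : K
  map_a : σ a = -a
  map_d : σ d = -d

namespace UnitaryUnipotent

open scoped commutatorElement

variable {K : Type*} [Field K] {σ : K →+* K} {hσ : Function.Involutive σ}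

instance : Mul (UnitaryUnipotent σ hσ) where
  mul x y :=
    { t := x.t + y.t
      a := x.a + y.a + σ x.t * y.b - x.t * σ y.b + x.t * σ x.t * y.d
      b := x.b + y.b + x.t * y.d
      d := x.d + y.d
      map_a := by
        simp only [map_add, map_sub, map_mul, x.map_a, y.map_a, y.map_d, hσ _]
        ring
      map_d := by
        rw [map_add, x.map_d, y.map_d]
        ring }

instance : One (UnitaryUnipotent σ hσ) where
  one := { t := 0, a := 0, b := 0, d := 0, map_a := by simp, map_d := by simp }

instance : Inv (UnitaryUnipotent σ hσ) where
  inv x :=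
    { t := -x.t
      a := -x.a + σ x.t * x.b - x.t * σ x.b - x.t * σ x.t * x.d
      b := -x.b + x.t * x.d
      d := -x.d
      map_a := by
        simp only [map_add, map_sub, map_neg, map_mul, x.map_a, x.map_d, hσ _]
        ring
      map_d := by rw [map_neg, x.map_d] }

@[simp] theorem mul_t (x y : UnitaryUnipotent σ hσ) : (x * y).t = x.t + y.t := rfl

@[simp] theorem mul_a (x y : UnitaryUnipotent σ hσ) :
    (x * y).a = x.a + y.a + σ x.t * y.b - x.t * σ y.b + x.t * σ x.t * y.d := rfl

@[simp] theorem mul_b (x y : UnitaryUnipotent σ hσ) : (x * y).b = x.b + y.b + x.t * y.d := rfl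

@[simp] theorem mul_d (x y : UnitaryUnipotent σ hσ) : (x * y).d = x.d + y.d := rfl

@[simp] theorem one_t : (1 : UnitaryUnipotent σ hσ).t = 0 := rfl

@[simp] theorem one_a : (1 : UnitaryUnipotent σ hσ).a = 0 := rfl

@[simp] theorem one_b : (1 : UnitaryUnipotent σ hσ).b = 0 := rfl

@[simp] theorem one_d : (1 : UnitaryUnipotent σ hσ).d = 0 := rfl

@[simp] theorem inv_t (x : UnitaryUnipotent σ hσ) : x⁻¹.t = -x.t := rfl

@[simp] theorem inv_a (x : UnitaryUnipotent σ hσ) :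
    x⁻¹.a = -x.a + σ x.t * x.b - x.t * σ x.b - x.t * σ x.t * x.d := rfl

@[simp] theorem inv_b (x : UnitaryUnipotent σ hσ) : x⁻¹.b = -x.b + x.t * x.d := rfl

@[simp] theorem inv_d (x : UnitaryUnipotent σ hσ) : x⁻¹.d = -x.d := rfl

instance : Group (UnitaryUnipotent σ hσ) :=
  Group.ofLeftAxioms
    (fun x y z => by
      ext
      · simp; ring
      · simp only [mul_a, mul_t, mul_b, mul_d, map_add, map_mul, z.map_d]; ring
      · simp; ring
      · simp; ring)
    (fun x => by ext <;> simp)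
    (fun x => by
      ext
      · simp
      · simp; ring
      · simp
      · simp)

theorem commute_iff (x y : UnitaryUnipotent σ hσ) :
    x * y = y * x ↔
      σ x.t * y.b - x.t * σ y.b + x.t * σ x.t * y.d =
        σ y.t * x.b - y.t * σ x.b + y.t * σ y.t * x.d ∧ x.t * y.d = y.t * x.d := by
  constructor
  · intro h
    have ha := congrArg UnitaryUnipotent.a h
    have hb := congrArg UnitaryUnipotent.b h
    simp only [mul_a, mul_b] at ha hb
    exact ⟨by linear_combination ha, by linear_combination hb⟩
  · rintro ⟨ha, hb⟩
    ext
    · simp [add_comm]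
    · simp only [mul_a]; linear_combination ha
    · simp only [mul_b]; linear_combination hb
    · simp [add_comm]

theorem commutator_t (x y : UnitaryUnipotent σ hσ) : ⁅x, y⁆.t = 0 := by
  simp [commutatorElement_def]

theorem commutator_b (x y : UnitaryUnipotent σ hσ) : ⁅x, y⁆.b = x.t * y.d - y.t * x.d := by
  simp [commutatorElement_def]; ring

theorem commutator_d (x y : UnitaryUnipotent σ hσ) : ⁅x, y⁆.d = 0 := by
  simp [commutatorElement_def]

variable (σ hσ) in
/-- The coordinates identify the unipotent group with a product of four sets. -/
def equivProd : UnitaryUnipotent σ hσ ≃ K × {a : K // σ a = -a} × K × {d : K // σ d = -d} where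
  toFun x := (x.t, ⟨x.a, x.map_a⟩, x.b, ⟨x.d, x.map_d⟩)
  invFun y := ⟨y.1, y.2.1, y.2.2.1, y.2.2.2, y.2.1.2, y.2.2.2.2⟩

instance [Finite K] : Finite (UnitaryUnipotent σ hσ) := Finite.of_equiv _ (equivProd σ hσ).symm

theorem card_eq {q : ℕ} (hK : Nat.card K = q ^ 2) (hskew : Nat.card {a : K // σ a = -a} = q) :
    Nat.card (UnitaryUnipotent σ hσ) = q ^ 6 := by
  rw [Nat.card_congr (equivProd σ hσ), Nat.card_prod, Nat.card_prod, Nat.card_prod, hK, hskew]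
  ring

variable (σ hσ) in
/-- The projection to the Levi coordinate. -/
def tHom : UnitaryUnipotent σ hσ →* Multiplicative K where
  toFun x := Multiplicative.ofAdd x.t
  map_one' := rfl
  map_mul' _ _ := rfl

variable (σ hσ) in
/-- The abelian normal subgroup of elements with trivial Levi coordinate. -/
def radical : Subgroup (UnitaryUnipotent σ hσ) := (tHom σ hσ).ker

theorem mem_radical {x : UnitaryUnipotent σ hσ} : x ∈ radical σ hσ ↔ x.t = 0 := Iff.rfl

theorem card_radical {q : ℕ} (hK : Nat.card K = q ^ 2)
    (hskew : Nat.card {a : K // σ a = -a} = q) : Nat.card (radical σ hσ) = q ^ 4 := by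
  let e : radical σ hσ ≃ {a : K // σ a = -a} × K × {d : K // σ d = -d} :=
    { toFun := fun x => (⟨x.1.a, x.1.map_a⟩, x.1.b, ⟨x.1.d, x.1.map_d⟩)
      invFun := fun y => ⟨⟨0, y.1, y.2.1, y.2.2, y.1.2, y.2.2.2⟩, mem_radical.2 rfl⟩
      left_inv := fun x => Subtype.ext (UnitaryUnipotent.ext (mem_radical.1 x.2).symm rfl rfl rfl)
      right_inv := fun _ => rfl }
  rw [Nat.card_congr e, Nat.card_prod, Nat.card_prod, hK, hskew]
  ring

theorem isElementaryAbelian_radical (p : ℕ) [CharP K p] :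
    IsElementaryAbelian p (radical σ hσ) := by
  refine ⟨fun x hx y hy => (commute_iff x y).2 ?_, fun x hx => ?_⟩
  · simp [mem_radical.1 hx, mem_radical.1 hy]
  · rw [mem_radical] at hx
    have hpow : ∀ k : ℕ, (x ^ k).t = 0 ∧ (x ^ k).a = k * x.a ∧ (x ^ k).b = k * x.b ∧
        (x ^ k).d = k * x.d := by
      intro k
      induction k with
      | zero => simp
      | succ k ih =>
        obtain ⟨h1, h2, h3, h4⟩ := ih
        rw [pow_succ]
        refine ⟨by simp [h1, hx], ?_, ?_, ?_⟩
        · simp [h1, h2]; ring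
        · simp [h1, h3]; ring
        · simp [h4]; ring
    obtain ⟨h1, h2, h3, h4⟩ := hpow p
    ext <;> simp [h1, h2, h3, h4]

/-- The solutions `t` of `σ t * b = t * σ b` form a line over the fixed field of `σ`. -/
def fixedLineEquiv {b : K} (hb : b ≠ 0) : {y : K // σ y = y} ≃ {t : K // σ t * b = t * σ b} where
  toFun y := ⟨y * b, by rw [map_mul, y.2]; ring⟩
  invFun t := ⟨t / b, by
    rw [map_div₀, div_eq_div_iff ((map_ne_zero σ).2 hb) hb, t.2]⟩
  left_inv y := Subtype.ext (mul_div_cancel_right₀ _ hb)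
  right_inv t := Subtype.ext (div_mul_cancel₀ _ hb)

/-- The solutions `t` of `σ t * b = -(t * σ b)` form a translate of the skew elements. -/
def skewLineEquiv {b : K} (hb : b ≠ 0) :
    {y : K // σ y = -y} ≃ {t : K // σ t * b = -(t * σ b)} where
  toFun y := ⟨y * b, by rw [map_mul, y.2]; ring⟩
  invFun t := ⟨t / b, by
    rw [map_div₀, ← neg_div, div_eq_div_iff ((map_ne_zero σ).2 hb) hb, t.2]; ring⟩
  left_inv y := Subtype.ext (mul_div_cancel_right₀ _ hb)
  right_inv t := Subtype.ext (div_mul_cancel₀ _ hb)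

theorem fixedLine_symm {b s t : K} (hb : b ≠ 0) (hs : σ s * b = s * σ b)
    (ht : σ t * b = t * σ b) : σ t * s = t * σ s := by
  refine mul_right_cancel₀ ((map_ne_zero σ).2 hb) ?_
  linear_combination -σ t * hs + σ s * ht

theorem card_le_of_commutative [Finite K] {q : ℕ} (hK : Nat.card K = q ^ 2)
    (hfix : Nat.card {a : K // σ a = a} = q) (hskew : Nat.card {a : K // σ a = -a} = q)
    (B : Subgroup (UnitaryUnipotent σ hσ)) (hB : ∀ x ∈ B, ∀ y ∈ B, x * y = y * x)
    (hBJ : ¬ B ≤ radical σ hσ) : Nat.card B ≤ q ^ 3 := by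
  obtain ⟨m, hmB, hm⟩ := SetLike.not_le_iff_exists.1 hBJ
  rw [mem_radical] at hm
  let f : B →* Multiplicative K := (tHom σ hσ).comp B.subtype
  have hf : ∀ x : B, x ∈ f.ker ↔ x.1.t = 0 := fun x => Iff.rfl
  have hcard : Nat.card B = Nat.card f.ker * Nat.card f.range := by
    rw [← Subgroup.index_ker, Subgroup.card_mul_index]
  have hker : ∀ x : B, x ∈ f.ker → x.1.d = 0 ∧ σ x.1.b * m.t = x.1.b * σ m.t := by
    intro x hx
    rw [hf] at hx
    obtain ⟨h1, h2⟩ := (commute_iff m x).1 (hB m hmB x x.2)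
    rw [hx] at h1 h2
    have hd : x.1.d = 0 := by simpa [hm] using h2
    rw [hd] at h1
    exact ⟨hd, by simp at h1; linear_combination -h1⟩
  by_cases h : ∃ x : B, x ∈ f.ker ∧ x.1.b ≠ 0
  · obtain ⟨x, hx, hb⟩ := h
    have h1 : Nat.card f.ker ≤ q * q := by
      rw [← congrArg₂ (· * ·) hskew hfix, Nat.card_congr (fixedLineEquiv (σ := σ) hm), ← Nat.card_prod]
      refine Nat.card_le_card_of_injective
        (fun y => (⟨y.1.1.a, y.1.1.map_a⟩, ⟨y.1.1.b, (hker y.1 y.2).2⟩)) fun y z hyz => ?_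
      simp only [Prod.mk.injEq, Subtype.mk.injEq] at hyz
      exact Subtype.ext (Subtype.ext (UnitaryUnipotent.ext
        (((hf y).1 y.2).trans ((hf z).1 z.2).symm) hyz.1 hyz.2
        ((hker y.1 y.2).1.trans (hker z.1 z.2).1.symm)))
    have h2 : Nat.card f.range ≤ q := by
      rw [← hfix, Nat.card_congr (fixedLineEquiv (σ := σ) hb)]
      refine Nat.card_le_card_of_injective (fun y => ⟨Multiplicative.toAdd y.1, ?_⟩)
        fun y z hyz => Subtype.ext (congrArg (fun w => w.1) hyz)
      obtain ⟨_, y, rfl⟩ := y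
      have h1 := ((commute_iff y.1 x).1 (hB y y.2 x x.2)).1
      rw [(hf x).1 hx, (hker x hx).1] at h1
      simp at h1
      change σ y.1.t * x.1.b = y.1.t * σ x.1.b
      linear_combination h1
    calc Nat.card B ≤ q * q * q := hcard ▸ Nat.mul_le_mul h1 h2
      _ = q ^ 3 := by ring
  · push Not at h
    have h1 : Nat.card f.ker ≤ q := by
      rw [← hskew]
      refine Nat.card_le_card_of_injective (fun y => ⟨y.1.1.a, y.1.1.map_a⟩) fun y z hyz => ?_
      simp only [Subtype.mk.injEq] at hyz
      exact Subtype.ext (Subtype.ext (UnitaryUnipotent.ext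
        (((hf y).1 y.2).trans ((hf z).1 z.2).symm) hyz ((h y.1 y.2).trans (h z.1 z.2).symm)
        ((hker y.1 y.2).1.trans (hker z.1 z.2).1.symm)))
    have h2 : Nat.card f.range ≤ q ^ 2 := by
      rw [← hK]
      exact Nat.card_le_card_of_injective (fun y => Multiplicative.toAdd y.1)
        fun y z hyz => Subtype.ext hyz
    calc Nat.card B ≤ q * q ^ 2 := hcard ▸ Nat.mul_le_mul h1 h2
      _ = q ^ 3 := by ring

theorem thompson_eq_radical [Finite K] {p q : ℕ} [CharP K p] (hq : 1 < q)
    (hK : Nat.card K = q ^ 2)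
    (hfix : Nat.card {a : K // σ a = a} = q) (hskew : Nat.card {a : K // σ a = -a} = q) :
    Thompson p (UnitaryUnipotent σ hσ) = radical σ hσ := by
  have hlt : q ^ 3 < q ^ 4 := Nat.pow_lt_pow_right hq (by norm_num)
  have hJ := card_radical (hσ := hσ) hK hskew
  refine le_antisymm (iSup₂_le fun A hA => ?_) (le_iSup₂_of_le (radical σ hσ) ?_ le_rfl)
  · by_contra hAJ
    have h1 := card_le_of_commutative hK hfix hskew A hA.1.1 hAJ
    have h2 := hA.2 _ (isElementaryAbelian_radical p)
    omega
  · refine ⟨isElementaryAbelian_radical p, fun B hB => ?_⟩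
    by_cases hBJ : B ≤ radical σ hσ
    · exact Subgroup.card_le_of_le hBJ
    · have := card_le_of_commutative hK hfix hskew B hB.1 hBJ
      omega

theorem mem_centralizer_singleton {x : UnitaryUnipotent σ hσ} (ht : x.t = 0) (hd : x.d = 0)
    (y : UnitaryUnipotent σ hσ) :
    y ∈ Subgroup.centralizer {x} ↔ σ y.t * x.b = y.t * σ x.b := by
  rw [Subgroup.mem_centralizer_singleton_iff, commute_iff, ht, hd]
  simp [sub_eq_zero]

/-- The elements with vanishing `t` and `d` whose coordinate `b` is orthogonal to `b₀`. -/
def fixedLineSubgroup (σ : K →+* K) (hσ : Function.Involutive σ) (b₀ : K) :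
    Subgroup (UnitaryUnipotent σ hσ) where
  carrier := {x | x.t = 0 ∧ x.d = 0 ∧ σ x.b * b₀ = x.b * σ b₀}
  one_mem' := by simp
  mul_mem' := by
    rintro x y ⟨h1, h2, h3⟩ ⟨h4, h5, h6⟩
    refine ⟨by simp [h1, h4], by simp [h2, h5], ?_⟩
    simp only [mul_b, h5, map_add, map_mul, map_zero]
    linear_combination h3 + h6
  inv_mem' := by
    rintro x ⟨h1, h2, h3⟩
    refine ⟨by simp [h1], by simp [h2], ?_⟩
    simp only [inv_b, h2, map_add, map_neg, map_mul, map_zero]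
    linear_combination -h3

/-- The elements with vanishing `t` and `d` whose coordinate `b` is a skew multiple of `b₀`. -/
def skewLineSubgroup (σ : K →+* K) (hσ : Function.Involutive σ) (b₀ : K) :
    Subgroup (UnitaryUnipotent σ hσ) where
  carrier := {x | x.t = 0 ∧ x.d = 0 ∧ σ x.b * b₀ = -(x.b * σ b₀)}
  one_mem' := by simp
  mul_mem' := by
    rintro x y ⟨h1, h2, h3⟩ ⟨h4, h5, h6⟩
    refine ⟨by simp [h1, h4], by simp [h2, h5], ?_⟩
    simp only [mul_b, h5, map_add, map_mul, map_zero]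
    linear_combination h3 + h6
  inv_mem' := by
    rintro x ⟨h1, h2, h3⟩
    refine ⟨by simp [h1], by simp [h2], ?_⟩
    simp only [inv_b, h2, map_add, map_neg, map_mul, map_zero]
    linear_combination -h3

theorem card_fixedLineSubgroup {q : ℕ} (hfix : Nat.card {a : K // σ a = a} = q)
    (hskew : Nat.card {a : K // σ a = -a} = q) {b₀ : K} (hb₀ : b₀ ≠ 0) :
    Nat.card (fixedLineSubgroup σ hσ b₀) = q ^ 2 := by
  let e : fixedLineSubgroup σ hσ b₀ ≃ {a : K // σ a = -a} × {b : K // σ b * b₀ = b * σ b₀} :=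
    { toFun := fun x => (⟨x.1.a, x.1.map_a⟩, ⟨x.1.b, x.2.2.2⟩)
      invFun := fun y => ⟨⟨0, y.1, y.2, 0, y.1.2, by simp⟩, rfl, rfl, y.2.2⟩
      left_inv := fun x => Subtype.ext (UnitaryUnipotent.ext x.2.1.symm rfl rfl x.2.2.1.symm)
      right_inv := fun _ => rfl }
  rw [Nat.card_congr e, Nat.card_prod, ← Nat.card_congr (fixedLineEquiv hb₀), hfix, hskew, sq]

theorem card_skewLineSubgroup {q : ℕ} (hskew : Nat.card {a : K // σ a = -a} = q) {b₀ : K}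
    (hb₀ : b₀ ≠ 0) : Nat.card (skewLineSubgroup σ hσ b₀) = q ^ 2 := by
  let e : skewLineSubgroup σ hσ b₀ ≃ {a : K // σ a = -a} × {b : K // σ b * b₀ = -(b * σ b₀)} :=
    { toFun := fun x => (⟨x.1.a, x.1.map_a⟩, ⟨x.1.b, x.2.2.2⟩)
      invFun := fun y => ⟨⟨0, y.1, y.2, 0, y.1.2, by simp⟩, rfl, rfl, y.2.2⟩
      left_inv := fun x => Subtype.ext (UnitaryUnipotent.ext x.2.1.symm rfl rfl x.2.2.1.symm)
      right_inv := fun _ => rfl }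
  rw [Nat.card_congr e, Nat.card_prod, ← Nat.card_congr (skewLineEquiv hb₀), hskew, sq]

theorem card_centralizer_singleton {q : ℕ} (hK : Nat.card K = q ^ 2)
    (hfix : Nat.card {a : K // σ a = a} = q) (hskew : Nat.card {a : K // σ a = -a} = q)
    {x : UnitaryUnipotent σ hσ} (ht : x.t = 0) (hd : x.d = 0) (hb : x.b ≠ 0) :
    Nat.card (Subgroup.centralizer {x}) = q ^ 5 := by
  let e : Subgroup.centralizer {x} ≃
      {t : K // σ t * x.b = t * σ x.b} × {a : K // σ a = -a} × K × {d : K // σ d = -d} :=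
    { toFun := fun y => (⟨y.1.t, (mem_centralizer_singleton ht hd y.1).1 y.2⟩,
        ⟨y.1.a, y.1.map_a⟩, y.1.b, ⟨y.1.d, y.1.map_d⟩)
      invFun := fun y => ⟨⟨y.1, y.2.1, y.2.2.1, y.2.2.2, y.2.1.2, y.2.2.2.2⟩,
        (mem_centralizer_singleton ht hd _).2 y.1.2⟩
      left_inv := fun _ => rfl
      right_inv := fun _ => rfl }
  rw [Nat.card_congr e, Nat.card_prod, Nat.card_prod, Nat.card_prod,
    ← Nat.card_congr (fixedLineEquiv hb), hfix, hK, hskew]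
  ring

theorem radical_le_centralizer_singleton {x : UnitaryUnipotent σ hσ} (ht : x.t = 0)
    (hd : x.d = 0) : radical σ hσ ≤ Subgroup.centralizer {x} := fun y hy => by
  rw [mem_centralizer_singleton ht hd, mem_radical.1 hy]
  simp

theorem centralizer_centralizer_singleton {η : K} (hη : η ≠ 0) (hση : σ η = -η)
    {x : UnitaryUnipotent σ hσ} (ht : x.t = 0) (hd : x.d = 0) (hb : x.b ≠ 0) :
    Subgroup.centralizer (Subgroup.centralizer {x} : Set (UnitaryUnipotent σ hσ)) =
      fixedLineSubgroup σ hσ x.b := by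
  ext y
  rw [Subgroup.mem_centralizer_iff]
  constructor
  · intro h
    have hyt : y.t = 0 := by
      have := ((commute_iff _ _).1 (h ⟨0, 0, 0, η, by simp, hση⟩
        (radical_le_centralizer_singleton ht hd (mem_radical.2 rfl)))).2
      simpa [hη] using this.symm
    obtain ⟨h1, h2⟩ := (commute_iff _ _).1 (h ⟨x.b, 0, 0, 0, by simp, by simp⟩
        ((mem_centralizer_singleton ht hd _).2 (mul_comm _ _)))
    have hyd : y.d = 0 := by simpa [hb] using h2
    refine ⟨hyt, hyd, ?_⟩
    simp only [hyt, hyd, map_zero] at h1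
    linear_combination -h1
  · rintro ⟨hyt, hyd, hyb⟩ z hz
    have hzt := (mem_centralizer_singleton ht hd z).1 hz
    rw [commute_iff, hyt, hyd]
    have := fixedLine_symm hb hyb hzt
    simp [this]

theorem commutator_centralizer_le {x : UnitaryUnipotent σ hσ} (ht : x.t = 0) (hd : x.d = 0) :
    ⁅Subgroup.centralizer {x}, Subgroup.centralizer {x}⁆ ≤ skewLineSubgroup σ hσ x.b := by
  rw [Subgroup.commutator_le]
  intro y hy z hz
  rw [mem_centralizer_singleton ht hd] at hy hz
  refine ⟨commutator_t y z, commutator_d y z, ?_⟩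
  rw [commutator_b, map_sub, map_mul, map_mul, y.map_d, z.map_d]
  linear_combination -z.d * hy + y.d * hz

theorem skewLineSubgroup_le_commutator {η β : K} (hη : η ≠ 0) (hση : σ η = -η)
    (hβ : β + σ β = 1) {x : UnitaryUnipotent σ hσ} (ht : x.t = 0) (hd : x.d = 0) (hb : x.b ≠ 0) :
    skewLineSubgroup σ hσ x.b ≤ ⁅radical σ hσ, Subgroup.centralizer {x}⁆ := by
  have hσb : σ x.b ≠ 0 := (map_ne_zero σ).2 hb
  have hcentral : ∀ z : UnitaryUnipotent σ hσ, z.t = 0 → z.b = 0 → z.d = 0 →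
      z ∈ ⁅radical σ hσ, Subgroup.centralizer {x}⁆ := by
    intro z hzt hzb hzd
    have hmem := Subgroup.commutator_mem_commutator
      (mem_radical.2 rfl : (⟨0, 0, -(β * z.a / σ x.b), 0, by simp, by simp⟩ :
        UnitaryUnipotent σ hσ) ∈ radical σ hσ)
      ((mem_centralizer_singleton ht hd _).2 (mul_comm _ _) :
        (⟨x.b, 0, 0, 0, by simp, by simp⟩ : UnitaryUnipotent σ hσ) ∈ Subgroup.centralizer {x})
    convert hmem using 1
    ext
    · rw [hzt, commutator_t]
    · simp [commutatorElement_def, hσ x.b, z.map_a]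
      field_simp
      linear_combination -z.a * hβ
    · rw [hzb, commutator_b]; simp
    · rw [hzd, commutator_d]
  rintro y ⟨hyt, hyd, hyb⟩
  have hmem := Subgroup.commutator_mem_commutator
    (mem_radical.2 rfl : (⟨0, 0, 0, -η, by simp, by simp [hση]⟩ :
        UnitaryUnipotent σ hσ) ∈ radical σ hσ)
    ((mem_centralizer_singleton ht hd _).2 (by
      simp only [map_div₀, hση]
      field_simp
      linear_combination -hyb) :
        (⟨y.b / η, 0, 0, 0, by simp, by simp⟩ : UnitaryUnipotent σ hσ) ∈ Subgroup.centralizer {x})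
  rw [← Subgroup.mul_mem_cancel_right _ (inv_mem hmem)]
  refine hcentral _ ?_ ?_ ?_
  · rw [mul_t, inv_t, commutator_t, hyt]; simp
  · rw [mul_b, inv_b, commutator_b, commutator_t, inv_d, commutator_d, hyt]; simp [hη]
  · rw [mul_d, inv_d, commutator_d, hyd]; simp

end UnitaryUnipotent

/-- The structure of centralizers of noncentral elements of the derived subgroup. -/
def HasDerivedCentralizerStructure (p q : ℕ) (G : Type*) [Group G] : Prop :=
  ∀ x : G, x ∈ (⁅(⊤ : Subgroup G), ⊤⁆ : Subgroup G) → x ∉ Subgroup.center G →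
    Thompson p G ≤ Subgroup.centralizer {x} ∧
    Nat.card (Subgroup.centralizer {x}) = q ^ 5 ∧
    Subgroup.centralizer {x} ⊓ Subgroup.centralizer (Subgroup.centralizer {x} : Set G) =
      Thompson p G ⊓ Subgroup.centralizer (Subgroup.centralizer {x} : Set G) ∧
    Nat.card ↥(Subgroup.centralizer {x} ⊓
      Subgroup.centralizer (Subgroup.centralizer {x} : Set G)) = q ^ 2 ∧
    ⁅Subgroup.centralizer {x}, Subgroup.centralizer {x}⁆ =
      ⁅Thompson p G, Subgroup.centralizer {x}⁆ ∧
    Nat.card ↥(⁅Subgroup.centralizer {x}, Subgroup.centralizer {x}⁆ : Subgroup G) = q ^ 2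

theorem UnitaryUnipotent.hasDerivedCentralizerStructure {K : Type*} [Field K] [Finite K]
    {σ : K →+* K} {hσ : Function.Involutive σ} {p q : ℕ} [CharP K p] (hq : 1 < q)
    (hK : Nat.card K = q ^ 2) (hfix : Nat.card {a : K // σ a = a} = q)
    (hskew : Nat.card {a : K // σ a = -a} = q) (htr : ∃ β : K, β + σ β = 1) :
    HasDerivedCentralizerStructure p q (UnitaryUnipotent σ hσ) := by
  intro x hx hxz
  obtain ⟨β, hβ⟩ := htr
  obtain ⟨η, hη, hση⟩ := exists_skew_ne_zero (hskew.symm ▸ hq)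
  obtain ⟨ht, hd⟩ : x.t = 0 ∧ x.d = 0 := by
    let D : Subgroup (UnitaryUnipotent σ hσ) :=
      { carrier := {y | y.t = 0 ∧ y.d = 0}
        one_mem' := ⟨rfl, rfl⟩
        mul_mem' := fun h h' => ⟨by simp [h.1, h'.1], by simp [h.2, h'.2]⟩
        inv_mem' := fun h => ⟨by simp [h.1], by simp [h.2]⟩ }
    have hD : ⁅(⊤ : Subgroup (UnitaryUnipotent σ hσ)), ⊤⁆ ≤ D :=
      Subgroup.commutator_le.2 fun y _ z _ => ⟨commutator_t y z, commutator_d y z⟩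
    exact hD hx
  have hb : x.b ≠ 0 := by
    intro hb
    refine hxz (Subgroup.mem_center_iff.2 fun y => (commute_iff _ _).2 ?_)
    simp [ht, hd, hb]
  rw [thompson_eq_radical hq hK hfix hskew, centralizer_centralizer_singleton hη hση ht hd hb]
  have hle := radical_le_centralizer_singleton ht hd
  have hline : fixedLineSubgroup σ hσ x.b ≤ radical σ hσ := fun y hy => mem_radical.2 hy.1
  have h1 := commutator_centralizer_le ht hd
  have h2 := skewLineSubgroup_le_commutator hη hση hβ ht hd hb
  have h3 : ⁅radical σ hσ, Subgroup.centralizer {x}⁆ ≤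
      ⁅Subgroup.centralizer {x}, Subgroup.centralizer {x}⁆ :=
    Subgroup.commutator_mono hle le_rfl
  refine ⟨hle, card_centralizer_singleton hK hfix hskew ht hd hb, ?_, ?_, ?_, ?_⟩
  · rw [inf_eq_right.2 hline, inf_eq_right.2 (hline.trans hle)]
  · rw [inf_eq_right.2 (hline.trans hle), card_fixedLineSubgroup hfix hskew hb]
  · exact le_antisymm (h1.trans h2) h3
  · rw [le_antisymm h1 (h2.trans h3), card_skewLineSubgroup hskew hb]

section Transport

variable {G H : Type*} [Group G] [Group H]

theorem Subgroup.map_mulEquiv_centralizer (e : G ≃* H) (s : Set G) :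
    (Subgroup.centralizer s).map e.toMonoidHom = Subgroup.centralizer (e '' s) := by
  ext y
  simp only [Subgroup.mem_map_equiv, Subgroup.mem_centralizer_iff, Set.forall_mem_image]
  refine forall₂_congr fun g _ => ?_
  rw [← e.injective.eq_iff]
  simp

theorem IsElementaryAbelian.map {p : ℕ} {A : Subgroup G} (hA : IsElementaryAbelian p A)
    (f : G →* H) : IsElementaryAbelian p (A.map f) := by
  refine ⟨?_, ?_⟩
  · rintro _ ⟨x, hx, rfl⟩ _ ⟨y, hy, rfl⟩
    rw [← map_mul, hA.1 x hx y hy, map_mul]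
  · rintro _ ⟨x, hx, rfl⟩
    rw [← map_pow, hA.2 x hx, map_one]

theorem Thompson.map_le (p : ℕ) (e : G ≃* H) :
    (Thompson p G).map e.toMonoidHom ≤ Thompson p H := by
  rw [Subgroup.map_le_iff_le_comap]
  refine iSup₂_le fun A hA => Subgroup.map_le_iff_le_comap.1 ?_
  refine le_iSup₂_of_le (A.map e.toMonoidHom) ⟨hA.1.map _, fun B hB => ?_⟩ le_rfl
  have h := hA.2 _ (hB.map e.symm.toMonoidHom)
  rwa [Subgroup.card_map_of_injective e.symm.injective,
    ← Subgroup.card_map_of_injective (K := A) (f := e.toMonoidHom) e.injective] at h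

theorem Thompson.map_mulEquiv (p : ℕ) (e : G ≃* H) :
    (Thompson p G).map e.toMonoidHom = Thompson p H := by
  refine le_antisymm (Thompson.map_le p e) fun y hy => ?_
  rw [Subgroup.mem_map_equiv]
  exact Thompson.map_le p e.symm (Subgroup.mem_map_of_mem _ hy)

theorem HasDerivedCentralizerStructure.of_mulEquiv {p q : ℕ}
    (hH : HasDerivedCentralizerStructure p q H) (e : G ≃* H) :
    HasDerivedCentralizerStructure p q G := by
  intro x hx hxz
  have hinj : Function.Injective (Subgroup.map e.toMonoidHom) :=
    Subgroup.map_injective e.injective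
  have hex : e x ∈ (⁅(⊤ : Subgroup H), ⊤⁆ : Subgroup H) := by
    have := Subgroup.mem_map_of_mem e.toMonoidHom hx
    rwa [Subgroup.map_commutator, Subgroup.map_top_of_surjective _ e.surjective] at this
  have hexz : e x ∉ Subgroup.center H := fun h => hxz <| Subgroup.mem_center_iff.2 fun g =>
    e.injective (by simpa using Subgroup.mem_center_iff.1 h (e g))
  obtain ⟨h1, h2, h3, h4, h5, h6⟩ := hH (e x) hex hexz
  have hC : (Subgroup.centralizer {x}).map e.toMonoidHom = Subgroup.centralizer {e x} := by
    rw [Subgroup.map_mulEquiv_centralizer, Set.image_singleton]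
  have hCC : (Subgroup.centralizer (Subgroup.centralizer {x} : Set G)).map e.toMonoidHom =
      Subgroup.centralizer (Subgroup.centralizer {e x} : Set H) := by
    rw [Subgroup.map_mulEquiv_centralizer, ← hC]
    rfl
  have hJ := Thompson.map_mulEquiv p e
  have hcard : ∀ A : Subgroup G, Nat.card A = Nat.card (A.map e.toMonoidHom) := fun A =>
    (Subgroup.card_map_of_injective e.injective).symm
  refine ⟨?_, ?_, hinj ?_, ?_, hinj ?_, ?_⟩
  · rwa [← Subgroup.map_le_map_iff_of_injective (f := e.toMonoidHom) e.injective, hJ, hC]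
  · rw [hcard, hC, h2]
  · rw [Subgroup.map_inf _ _ _ e.injective, Subgroup.map_inf _ _ _ e.injective, hC, hCC, hJ, h3]
  · rw [hcard, Subgroup.map_inf _ _ _ e.injective, hC, hCC, h4]
  · rw [Subgroup.map_commutator, Subgroup.map_commutator, hC, hJ, h5]
  · rw [hcard, Subgroup.map_commutator, hC, h6]

end Transport

namespace UnitaryUnipotent

variable {K : Type*} [Field K] {σ : K →+* K} {hσ : Function.Involutive σ}

/-- The upper unitriangular matrix with the given coordinates. -/
def toMatrix (x : UnitaryUnipotent σ hσ) : Matrix (Fin 4) (Fin 4) K :=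
  !![1, x.t, x.b, x.a - x.b * σ x.t;
     0, 1, x.d, -σ x.b - x.d * σ x.t;
     0, 0, 1, -σ x.t;
     0, 0, 0, 1]

variable (K) in
/-- The antidiagonal Gram matrix. -/
def gram : Matrix (Fin 4) (Fin 4) K := !![0, 0, 0, 1; 0, 0, 1, 0; 0, 1, 0, 0; 1, 0, 0, 0]

theorem toMatrix_mul (x y : UnitaryUnipotent σ hσ) :
    (x * y).toMatrix = x.toMatrix * y.toMatrix := by
  ext i j
  fin_cases i <;> fin_cases j <;>
    simp [toMatrix, Matrix.mul_apply, Fin.sum_univ_four, y.map_d] <;> ring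

theorem toMatrix_one : (1 : UnitaryUnipotent σ hσ).toMatrix = 1 := by
  ext i j
  fin_cases i <;> fin_cases j <;> simp [toMatrix]

theorem det_toMatrix (x : UnitaryUnipotent σ hσ) : x.toMatrix.det = 1 := by
  rw [Matrix.det_of_isUpperTriangular]
  · simp [toMatrix, Fin.prod_univ_four]
  · intro i j hij
    fin_cases i <;> fin_cases j <;> first | rfl | exact absurd hij (by decide)

variable (σ hσ) in
/-- The embedding of the coordinate group in the special linear group. -/
def toSL : UnitaryUnipotent σ hσ →* SpecialLinearGroup (Fin 4) K where
  toFun x := ⟨x.toMatrix, x.det_toMatrix⟩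
  map_one' := Subtype.ext toMatrix_one
  map_mul' x y := Subtype.ext (toMatrix_mul x y)

theorem toMatrix_preserves_gram (x : UnitaryUnipotent σ hσ) :
    x.toMatrixᵀ * gram K * x.toMatrix.map σ = gram K := by
  ext i j
  fin_cases i <;> fin_cases j <;>
    simp [toMatrix, gram, Matrix.mul_apply, Fin.sum_univ_four, x.map_d, x.map_a, hσ _] <;> ring

theorem det_gram : (gram K).det = 1 := by
  simp [gram, Matrix.det_succ_row_zero, Fin.sum_univ_succ, Fin.succAbove]
  norm_num

theorem gram_preserves_gram : (gram K)ᵀ * gram K * (gram K).map σ = gram K := by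
  ext i j
  fin_cases i <;> fin_cases j <;> simp [gram, Matrix.mul_apply, Fin.sum_univ_four]

theorem eq_one_of_commute_gram {x : UnitaryUnipotent σ hσ}
    (h : x.toMatrix * gram K = gram K * x.toMatrix) : x = 1 := by
  have h' := fun i j => congrFun (congrFun h i) j
  have h1 := h' 0 0
  have h2 := h' 0 1
  have h3 := h' 0 2
  have h4 := h' 1 1
  simp [toMatrix, gram, Matrix.mul_apply, Fin.sum_univ_four] at h1 h2 h3 h4
  ext
  · exact h3
  · simpa [h2] using h1
  · exact h2
  · exact h4

theorem exists_toMatrix_eq (hσ : Function.Involutive σ) {g : Matrix (Fin 4) (Fin 4) K}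
    (hform : gᵀ * gram K * g.map σ = gram K) (htri : ∀ i j, j < i → g i j = 0)
    (hdiag : ∀ i, g i i = 1) : ∃ x : UnitaryUnipotent σ hσ, x.toMatrix = g := by
  have hz : g 1 0 = 0 ∧ g 2 0 = 0 ∧ g 3 0 = 0 ∧ g 2 1 = 0 ∧ g 3 1 = 0 ∧ g 3 2 = 0 := by
    refine ⟨?_, ?_, ?_, ?_, ?_, ?_⟩ <;> exact htri _ _ (by decide)
  obtain ⟨z1, z2, z3, z4, z5, z6⟩ := hz
  have o0 := hdiag 0
  have o1 := hdiag 1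
  have o2 := hdiag 2
  have o3 := hdiag 3
  have h' := fun i j => congrFun (congrFun hform i) j
  have h1 := h' 3 1
  have h2 := h' 3 2
  have h3 := h' 2 2
  have h4 := h' 3 3
  simp [gram, Matrix.mul_apply, Fin.sum_univ_four, z4, z5, z6, o1, o2, o3]
    at h1 h2 h3 h4
  have hs : g 2 3 = -σ (g 0 1) := by linear_combination h1
  have hd : σ (g 1 2) = -g 1 2 := by linear_combination h3
  have hf : g 1 3 = -σ (g 0 2) - g 1 2 * σ (g 0 1) := by
    rw [hd, hs] at h2
    linear_combination h2
  refine ⟨⟨g 0 1, g 0 3 + g 0 2 * σ (g 0 1), g 0 2, g 1 2, ?_, hd⟩, ?_⟩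
  · rw [hf, hs] at h4
    simp only [map_add, map_mul, map_neg, map_sub, hσ _, hd] at h4 ⊢
    linear_combination h4
  · ext i j
    fin_cases i <;> fin_cases j <;>
      simp [toMatrix, z1, z2, z3, z4, z5, z6, o0, o1, o2, o3, hs, hf]

theorem upperTriangular_of_normalizes (hσ : Function.Involutive σ) {η : K} (hη : η ≠ 0)
    (hση : σ η = -η) {g : Matrix (Fin 4) (Fin 4) K} (hdet : g.det ≠ 0)
    (hform : gᵀ * gram K * g.map σ = gram K)
    (hnorm : ∀ y : UnitaryUnipotent σ hσ, ∃ x : UnitaryUnipotent σ hσ,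
      y.toMatrix * g = g * x.toMatrix) : ∀ i j, j < i → g i j = 0 := by
  obtain ⟨xt, ht⟩ := hnorm ⟨1, 0, 0, 0, by simp, by simp⟩
  obtain ⟨xb, hb⟩ := hnorm ⟨0, 0, 1, 0, by simp, by simp⟩
  obtain ⟨xd, hd⟩ := hnorm ⟨0, 0, 0, η, by simp, hση⟩
  replace ht := fun i j => congrFun (congrFun ht i) j
  replace hb := fun i j => congrFun (congrFun hb i) j
  replace hd := fun i j => congrFun (congrFun hd i) j
  have h10 := ht 0 0
  have h30 := ht 2 0
  have h20 := hb 0 0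
  simp [toMatrix, Matrix.mul_apply, Fin.sum_univ_four] at h10 h30 h20
  have h31 := ht 2 1
  have h21 := hd 1 1
  simp [toMatrix, Matrix.mul_apply, Fin.sum_univ_four, h10, h20, hη] at h31 h21
  have h00 : g 0 0 ≠ 0 := by
    intro h
    refine hdet (Matrix.det_eq_zero_of_column_eq_zero 0 fun i => ?_)
    fin_cases i
    exacts [h, h10, h20, h30]
  have h32 := congrFun (congrFun hform 0) 2
  simp [gram, Matrix.mul_apply, Fin.sum_univ_four, h10, h20, h30, h00] at h32
  intro i j hij
  fin_cases i <;> fin_cases j <;>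
    first | exact absurd hij (by decide) | assumption

end UnitaryUnipotent

theorem Matrix.pow_apply_of_upperTriangular {R m : Type*} [CommRing R] [Fintype m]
    [LinearOrder m] {g : Matrix m m R} (hg : ∀ i j, j < i → g i j = 0) (k : ℕ) :
    (∀ i j, j < i → (g ^ k) i j = 0) ∧ ∀ i, (g ^ k) i i = g i i ^ k := by
  induction k with
  | zero => exact ⟨fun i j h => by simp [h.ne'], fun i => by simp⟩
  | succ k ih =>
    rw [pow_succ]
    refine ⟨fun i j hij => ?_, fun i => ?_⟩
    · rw [Matrix.mul_apply]
      refine Finset.sum_eq_zero fun l _ => ?_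
      rcases lt_or_ge l i with hl | hl
      · rw [ih.1 i l hl, zero_mul]
      · rw [hg l j (hij.trans_le hl), mul_zero]
    · rw [Matrix.mul_apply, Finset.sum_eq_single i, ih.2, pow_succ]
      · intro l _ hl
        rcases lt_or_gt_of_ne hl with hl | hl
        · rw [ih.1 i l hl, zero_mul]
        · rw [hg l i hl, mul_zero]
      · simp

theorem exists_wittBasis {K : Type*} [Field K] {σ : K →+* K} {β ε : K} (hβ : β + σ β = 1)
    (hε : ε * σ ε = -1) :
    ∃ C : SpecialLinearGroup (Fin 4) K,
      C.1ᵀ * C.1.map σ = UnitaryUnipotent.gram K := by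
  have hε0 : ε ≠ 0 := by
    rintro rfl
    simp at hε
  have hσβ : σ β = 1 - β := by linear_combination hβ
  have hδ : ε⁻¹ * (σ ε)⁻¹ = -1 := by rw [← mul_inv, hε, inv_neg, inv_one]
  refine ⟨⟨!![1, 0, 0, 1 - β; ε, 0, 0, -(β * ε); 0, 1, 1 - β, 0; 0, ε⁻¹, -(β * ε⁻¹), 0], ?_⟩, ?_⟩
  · simp [Matrix.det_succ_row_zero, Fin.sum_univ_succ, Fin.succAbove]
    field_simp
    ring
  · ext i j
    fin_cases i <;> fin_cases j <;>
      simp [UnitaryUnipotent.gram, Matrix.mul_apply, Fin.sum_univ_four, hσβ]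
    · linear_combination hε
    · linear_combination -(1 - β) * hε
    · linear_combination hδ
    · linear_combination -(1 - β) * hδ
    · linear_combination -β * hδ
    · linear_combination β * (1 - β) * hδ
    · linear_combination -β * hε
    · linear_combination β * (1 - β) * hε

theorem Matrix.preserves_gram_iff {K m : Type*} [Field K] [Fintype m] [DecidableEq m]
    {σ : K →+* K} {C A g M : Matrix m m K} (hC : IsUnit C) (hM : Cᵀ * C.map σ = M)
    (h : A * C = C * g) : Aᵀ * A.map σ = 1 ↔ gᵀ * M * g.map σ = M := by
  have h1 : gᵀ * M * g.map σ = Cᵀ * (Aᵀ * A.map σ) * C.map σ := by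
    calc gᵀ * M * g.map σ = (C * g)ᵀ * (C * g).map σ := by
          rw [← hM, Matrix.transpose_mul, Matrix.map_mul]; simp only [Matrix.mul_assoc]
      _ = _ := by
          rw [← h, Matrix.transpose_mul, Matrix.map_mul]; simp only [Matrix.mul_assoc]
  have hCt : IsUnit Cᵀ := (Matrix.isUnit_transpose C).2 hC
  have hCσ : IsUnit (C.map σ) := hC.map (RingHom.mapMatrix σ)
  rw [h1]
  constructor
  · intro hA
    rw [hA, mul_one, hM]
  · intro hA
    rw [← hM, hCσ.mul_left_inj] at hA
    exact hCt.mul_left_cancel (hA.trans (mul_one _).symm)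

theorem IsPGroup.le_of_normalizer_inf_le {G : Type*} [Group G] [Finite G] {p : ℕ} [Fact p.Prime]
    {P Q : Subgroup G} (hQ : IsPGroup p Q)
    (h : ∀ g ∈ Q, g ∈ Subgroup.normalizer (P : Set G) → g ∈ P) (hPQ : P ≤ Q) : Q ≤ P := by
  have : Group.IsNilpotent Q := hQ.isNilpotent
  rw [← Subgroup.subgroupOf_eq_top]
  by_contra hne
  obtain ⟨g, hg, hgP⟩ := SetLike.exists_of_lt
    (Group.normalizerCondition_of_isNilpotent (P.subgroupOf Q) (lt_top_iff_ne_top.2 hne))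
  refine hgP (Subgroup.mem_subgroupOf.2 (h g g.2 ?_))
  rw [Subgroup.mem_normalizer_iff] at hg ⊢
  intro x
  constructor
  · intro hx
    exact (hg ⟨x, hPQ hx⟩).1 hx
  · intro hx
    have hxQ : x ∈ Q := by
      have := Q.mul_mem (Q.mul_mem (Q.inv_mem g.2) (hPQ hx)) g.2
      simpa [mul_assoc] using this
    exact (hg ⟨x, hxQ⟩).2 hx

theorem frobq_apply (p n : ℕ) [Fact p.Prime] (x : GaloisField p (2 * n)) :
    frobq p n x = x ^ p ^ n := iterateFrobenius_def _ _ _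

theorem GaloisField.card_two_mul (p n : ℕ) [Fact p.Prime] (hn : 0 < n) :
    Nat.card (GaloisField p (2 * n)) = (p ^ n) ^ 2 := by
  rw [GaloisField.card p (2 * n) (by omega), ← pow_mul, mul_comm]

theorem frobq_involutive (p n : ℕ) [Fact p.Prime] (hn : 0 < n) :
    Function.Involutive (frobq p n) := fun x => by
  have := Fintype.ofFinite (GaloisField p (2 * n))
  rw [frobq_apply, frobq_apply, ← pow_mul, ← sq, ← GaloisField.card_two_mul p n hn,
    Nat.card_eq_fintype_card, FiniteField.pow_card]

section Embedding

variable {p n : ℕ} [Fact p.Prime] {hσ : Function.Involutive (frobq p n)}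
  {C : SpecialLinearGroup (Fin 4) (GaloisField p (2 * n))}

theorem mem_SU4_iff_conj
    (hC : C.1ᵀ * C.1.map (frobq p n) = UnitaryUnipotent.gram (GaloisField p (2 * n)))
    {A g : SpecialLinearGroup (Fin 4) (GaloisField p (2 * n))} (h : A * C = C * g) :
    A ∈ SU4 p n ↔ g.1ᵀ * UnitaryUnipotent.gram (GaloisField p (2 * n)) * g.1.map (frobq p n) =
      UnitaryUnipotent.gram (GaloisField p (2 * n)) := by
  refine Matrix.preserves_gram_iff ?_ hC (congrArg Subtype.val h)
  rw [Matrix.isUnit_iff_isUnit_det, C.2]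
  exact isUnit_one

variable (hσ) in
/-- The coordinate group acts by isometries in a basis with antidiagonal Gram matrix. -/
noncomputable def UnitaryUnipotent.toSU4
    (hC : C.1ᵀ * C.1.map (frobq p n) = UnitaryUnipotent.gram (GaloisField p (2 * n))) :
    UnitaryUnipotent (frobq p n) hσ →* SU4 p n :=
  ((MulAut.conj C).toMonoidHom.comp (UnitaryUnipotent.toSL (frobq p n) hσ)).codRestrict (SU4 p n)
    fun x => (mem_SU4_iff_conj hC (g := UnitaryUnipotent.toSL _ hσ x) (by simp)).2
      x.toMatrix_preserves_gram

theorem UnitaryUnipotent.coe_toSU4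
    (hC : C.1ᵀ * C.1.map (frobq p n) = UnitaryUnipotent.gram (GaloisField p (2 * n)))
    (x : UnitaryUnipotent (frobq p n) hσ) :
    (UnitaryUnipotent.toSU4 hσ hC x).1 = C * UnitaryUnipotent.toSL _ hσ x * C⁻¹ := rfl

theorem UnitaryUnipotent.eq_one_of_toSU4_mem_center
    (hC : C.1ᵀ * C.1.map (frobq p n) = UnitaryUnipotent.gram (GaloisField p (2 * n)))
    {x : UnitaryUnipotent (frobq p n) hσ}
    (hx : UnitaryUnipotent.toSU4 hσ hC x ∈ Subgroup.center (SU4 p n)) : x = 1 := by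
  let w : SpecialLinearGroup (Fin 4) (GaloisField p (2 * n)) :=
    ⟨UnitaryUnipotent.gram _, UnitaryUnipotent.det_gram⟩
  have hw : C * w * C⁻¹ ∈ SU4 p n :=
    (mem_SU4_iff_conj hC (g := w) (by simp)).2 UnitaryUnipotent.gram_preserves_gram
  have h := congrArg Subtype.val (Subgroup.mem_center_iff.1 hx ⟨_, hw⟩)
  simp only [Subgroup.coe_mul, UnitaryUnipotent.coe_toSU4] at h
  have h' : w * UnitaryUnipotent.toSL _ hσ x = UnitaryUnipotent.toSL _ hσ x * w := by
    refine mul_right_cancel (b := C⁻¹) ?_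
    simpa [mul_assoc] using h
  exact UnitaryUnipotent.eq_one_of_commute_gram (congrArg Subtype.val h').symm

theorem UnitaryUnipotent.mem_range_toSU4_of_normalizes
    (hC : C.1ᵀ * C.1.map (frobq p n) = UnitaryUnipotent.gram (GaloisField p (2 * n)))
    {η : GaloisField p (2 * n)} (hη : η ≠ 0) (hση : frobq p n η = -η) {A : SU4 p n}
    (hA : A ∈ Subgroup.normalizer ((UnitaryUnipotent.toSU4 hσ hC).range : Set (SU4 p n)))
    {k : ℕ} (hk : A ^ p ^ k = 1) : A ∈ (UnitaryUnipotent.toSU4 hσ hC).range := by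
  set g : SpecialLinearGroup (Fin 4) (GaloisField p (2 * n)) := C⁻¹ * A * C with hg
  have hAg : A.1 * C = C * g := by simp [hg, mul_assoc]
  have hform := (mem_SU4_iff_conj hC hAg).1 A.2
  have hnorm : ∀ y : UnitaryUnipotent (frobq p n) hσ, ∃ x : UnitaryUnipotent (frobq p n) hσ,
      y.toMatrix * g.1 = g.1 * x.toMatrix := by
    intro y
    obtain ⟨x, hx⟩ := (Subgroup.mem_normalizer_iff''.1 hA _).1 ⟨y, rfl⟩
    refine ⟨x, congrArg Subtype.val (?_ : UnitaryUnipotent.toSL _ hσ y * g =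
      g * UnitaryUnipotent.toSL _ hσ x)⟩
    have h := congrArg Subtype.val hx
    simp only [Subgroup.coe_mul, Subgroup.coe_inv, UnitaryUnipotent.coe_toSU4] at h
    have h2 : UnitaryUnipotent.toSL _ hσ x =
        C⁻¹ * (A.1⁻¹ * (C * UnitaryUnipotent.toSL _ hσ y * C⁻¹) * A.1) * C := by
      rw [← h]; group
    rw [h2, hg]
    group
  have htri := UnitaryUnipotent.upperTriangular_of_normalizes hσ hη hση
    (by rw [g.2]; exact one_ne_zero) hform hnorm
  have hgk : g.1 ^ p ^ k = 1 := by
    have h : g ^ p ^ k = 1 := by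
      have hA' : A.1 ^ p ^ k = 1 := congrArg Subtype.val hk
      have h := conj_pow (i := p ^ k) (a := C⁻¹) (b := A.1)
      rw [inv_inv, ← hg, hA'] at h
      rw [h]; group
    simpa using congrArg Subtype.val h
  have hdiag : ∀ i, g.1 i i = 1 := by
    intro i
    have h := (Matrix.pow_apply_of_upperTriangular htri (p ^ k)).2 i
    rw [hgk, Matrix.one_apply_eq] at h
    refine iterateFrobenius_inj (GaloisField p (2 * n)) p k ?_
    rw [iterateFrobenius_def, iterateFrobenius_def, one_pow, ← h]
  obtain ⟨x, hx⟩ := UnitaryUnipotent.exists_toMatrix_eq hσ hform htri hdiag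
  refine ⟨x, Subtype.ext ?_⟩
  have hxg : UnitaryUnipotent.toSL _ hσ x = g := Subtype.ext hx
  rw [UnitaryUnipotent.coe_toSU4, hxg, hg]
  group

end Embedding

theorem nonempty_sylow_mulEquiv (p n : ℕ) [Fact p.Prime] (hn : 0 < n)
    (S : Sylow p (PSU4 p n)) :
    Nonempty (S ≃* UnitaryUnipotent (frobq p n) (frobq_involutive p n hn)) := by
  have hK := GaloisField.card_two_mul p n hn
  have hfrob := frobq_apply p n
  have hσ := frobq_involutive p n hn
  obtain ⟨-, hskew, β, hβ⟩ := exists_frobenius_card_facts hK _ hfrob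
  obtain ⟨ε, hε⟩ := exists_mul_frobenius_eq_neg_one hK _ hfrob
  obtain ⟨η, hη, hση⟩ := exists_skew_ne_zero (σ := frobq p n)
    (hskew.symm ▸ Nat.one_lt_pow hn.ne' (Fact.out : p.Prime).one_lt)
  obtain ⟨C, hC⟩ := exists_wittBasis hβ hε
  let ψ := UnitaryUnipotent.toSU4 hσ hC
  have hψ : Function.Injective ((QuotientGroup.mk' (Subgroup.center (SU4 p n))).comp ψ) := by
    refine (injective_iff_map_eq_one _).2 fun x hx =>
      UnitaryUnipotent.eq_one_of_toSU4_mem_center hC ((QuotientGroup.eq_one_iff _).1 hx)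
  have hP : IsPGroup p ψ.range := by
    refine IsPGroup.of_card (n := n * 6) ?_
    rw [pow_mul, ← UnitaryUnipotent.card_eq (hσ := hσ) hK hskew]
    exact (Nat.card_congr (MonoidHom.ofInjective
      (Function.Injective.of_comp (f := QuotientGroup.mk' _) hψ)).toEquiv).symm
  let P : Sylow p (SU4 p n) :=
    { ψ.range with
      isPGroup' := hP
      is_maximal' := fun {Q} hQ hle => le_antisymm
        (hQ.le_of_normalizer_inf_le (fun A hAQ hA => by
          obtain ⟨k, hk⟩ := hQ ⟨A, hAQ⟩
          exact UnitaryUnipotent.mem_range_toSU4_of_normalizes hC hη hση hA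
            (congrArg Subtype.val hk)) hle) hle }
  have hrange : ((P.mapSurjective (QuotientGroup.mk'_surjective (Subgroup.center (SU4 p n))) :
      Sylow p (PSU4 p n)) : Subgroup (PSU4 p n)) =
        ((QuotientGroup.mk' (Subgroup.center (SU4 p n))).comp ψ).range := by
    rw [Sylow.coe_mapSurjective, MonoidHom.range_comp]
  exact ⟨((S.equiv _).trans (MulEquiv.subgroupCongr hrange)).trans
    (MonoidHom.ofInjective hψ).symm⟩

/-- For `q > 2` and `x ∈ ⁅S,S⁆ \ Z(S)`: `J(S) ≤ C_S(x)`, `|C_S(x)| = q⁵`,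
`Z(C_S(x)) = C_{J(S)}(C_S(x))` has order `q²`, and
`⁅C_S(x),C_S(x)⁆ = [J(S), C_S(x)]` has order `q²`. -/
theorem psu4_sylow_centralizer_of_derived_element
    (p n : ℕ) [Fact p.Prime] (hn : 0 < n) (q : ℕ) (hq : q = p ^ n) (hq2 : 2 < q)
    (S : Sylow p (PSU4 p n))
    (x : ↥(S : Subgroup (PSU4 p n)))
    (hx : x ∈ (⁅(⊤ : Subgroup ↥(S : Subgroup (PSU4 p n))), ⊤⁆ : Subgroup ↥(S : Subgroup (PSU4 p n))))
    (hxz : x ∉ Subgroup.center ↥(S : Subgroup (PSU4 p n))) :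
    Thompson p ↥(S : Subgroup (PSU4 p n)) ≤ Subgroup.centralizer {x} ∧
    Nat.card ↥(Subgroup.centralizer ({x} : Set ↥(S : Subgroup (PSU4 p n)))) = q ^ 5 ∧
    Subgroup.centralizer ({x} : Set ↥(S : Subgroup (PSU4 p n))) ⊓
        Subgroup.centralizer (Subgroup.centralizer ({x} : Set ↥(S : Subgroup (PSU4 p n))) : Set ↥(S : Subgroup (PSU4 p n))) =
      Thompson p ↥(S : Subgroup (PSU4 p n)) ⊓
        Subgroup.centralizer (Subgroup.centralizer ({x} : Set ↥(S : Subgroup (PSU4 p n))) : Set ↥(S : Subgroup (PSU4 p n))) ∧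
    Nat.card ↥(Subgroup.centralizer ({x} : Set ↥(S : Subgroup (PSU4 p n))) ⊓
      Subgroup.centralizer (Subgroup.centralizer ({x} : Set ↥(S : Subgroup (PSU4 p n))) : Set ↥(S : Subgroup (PSU4 p n)))) = q ^ 2 ∧
    ⁅Subgroup.centralizer ({x} : Set ↥(S : Subgroup (PSU4 p n))), Subgroup.centralizer ({x} : Set ↥(S : Subgroup (PSU4 p n)))⁆ =
      ⁅Thompson p ↥(S : Subgroup (PSU4 p n)), Subgroup.centralizer ({x} : Set ↥(S : Subgroup (PSU4 p n)))⁆ ∧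
    Nat.card ↥(⁅Subgroup.centralizer ({x} : Set ↥(S : Subgroup (PSU4 p n))),
      Subgroup.centralizer ({x} : Set ↥(S : Subgroup (PSU4 p n)))⁆ : Subgroup ↥(S : Subgroup (PSU4 p n))) = q ^ 2 := by
  have hq1 : 1 < q := by omega
  subst hq
  have hK := GaloisField.card_two_mul p n hn
  obtain ⟨hfix, hskew, htr⟩ := exists_frobenius_card_facts hK _ (frobq_apply p n)
  obtain ⟨e⟩ := nonempty_sylow_mulEquiv p n hn S
  exact (UnitaryUnipotent.hasDerivedCentralizerStructure hq1 hK hfix hskew htr).of_mulEquiv e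
    x hx hxz
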